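/- arXiv:2411.17574 — 2 statements merged into one kernel-verified Lean document; each statement's English description precedes it below -/
import Mathlib

section
/- Let V ⊂ ℝ¹⁰ be the set of 18 points e₁, e₂, e₃, e₄, −(e₁+e₂+e₃+e₄), e₅, e₆, e₇, e₈, −(e₅+e₆+e₇+e₈), e₉, −e₉, e₁₀, −e₁₀, e₁+e₅, e₁+e₅+e₉, e₂+e₆, e₂+e₆+e₁₀, and define P = {x ∈ ℝ¹⁰ : ⟨x, v⟩ ≥ −1 for every v ∈ V}. Then P is a compact convex polytope, every extreme point of P lies in ℤ¹⁰, and P has exactly 500 extreme points. -/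
noncomputable section

open MeasureTheory
open scoped RealInnerProductSpace

/-- The standard basis vectors of `ℝ¹⁰`. -/
def ee (i : Fin 10) : EuclideanSpace ℝ (Fin 10) := EuclideanSpace.single i 1

/-- The 18 points `e₁, e₂, e₃, e₄, −(e₁+e₂+e₃+e₄), e₅, e₆, e₇, e₈, −(e₅+e₆+e₇+e₈),
e₉, −e₉, e₁₀, −e₁₀, e₁+e₅, e₁+e₅+e₉, e₂+e₆, e₂+e₆+e₁₀` (0-indexed here). -/
def V18 : Set (EuclideanSpace ℝ (Fin 10)) :=
  {ee 0, ee 1, ee 2, ee 3, -(ee 0 + ee 1 + ee 2 + ee 3),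
   ee 4, ee 5, ee 6, ee 7, -(ee 4 + ee 5 + ee 6 + ee 7),
   ee 8, -ee 8, ee 9, -ee 9,
   ee 0 + ee 4, ee 0 + ee 4 + ee 8,
   ee 1 + ee 5, ee 1 + ee 5 + ee 9}

/-- The moment polytope `P = {x ∈ ℝ¹⁰ : ⟪x, v⟫ ≥ −1 for every v ∈ V18}`. -/
def P : Set (EuclideanSpace ℝ (Fin 10)) := {x | ∀ v ∈ V18, ⟪x, v⟫ ≥ -1}


open Filter Topology

abbrev E10 := EuclideanSpace ℝ (Fin 10)

lemma V18_finite : V18.Finite := by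
  unfold V18
  exact Set.toFinite _

/-- Rank characterisation of the extreme points. -/
lemma ext_iff (x : E10) : x ∈ Set.extremePoints ℝ P ↔
    x ∈ P ∧ ∀ d : E10, (∀ v ∈ V18, ⟪x, v⟫ = -1 → ⟪d, v⟫ = 0) → d = 0 := by
  constructor
  · rintro ⟨hx, hext⟩
    refine ⟨hx, fun d hd => ?_⟩
    have h1 : ∀ d : E10, (∀ v ∈ V18, ⟪x, v⟫ = -1 → ⟪d, v⟫ = 0) →
        ∀ᶠ ε : ℝ in 𝓝[>] 0, x + ε • d ∈ P := by
      intro d hd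
      have : ∀ᶠ ε : ℝ in 𝓝[>] 0, ∀ v ∈ V18, ⟪x + ε • d, v⟫ ≥ -1 := by
        rw [Filter.eventually_all_finite V18_finite]
        intro v hv
        rcases eq_or_lt_of_le (hx v hv) with h | h
        · filter_upwards with ε
          rw [inner_add_left, inner_smul_left, hd v hv h.symm, ← h]
          simp
        · have hc : Continuous fun ε : ℝ => ⟪x + ε • d, v⟫ := by fun_prop
          have ht : Tendsto (fun ε : ℝ => ⟪x + ε • d, v⟫) (𝓝[>] 0) (𝓝 ⟪x, v⟫) := by
            have := hc.tendsto 0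
            simp only [zero_smul, add_zero] at this
            exact this.mono_left nhdsWithin_le_nhds
          filter_upwards [ht.eventually (lt_mem_nhds h)] with ε hε
          exact hε.le
      exact this
    have hn := h1 (-d) (fun v hv h => by rw [inner_neg_left, hd v hv h, neg_zero])
    obtain ⟨ε, ⟨ha, hb⟩, hε⟩ := ((h1 d hd).and hn |>.and self_mem_nhdsWithin).exists
    have hε : 0 < ε := hε
    have := hext ha hb ⟨1/2, 1/2, by norm_num, by norm_num, by norm_num, by
      module⟩
    have h2 : ε • d = 0 := by simpa using this
    exact (smul_eq_zero.mp h2).resolve_left hε.ne'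
  · rintro ⟨hx, hd⟩
    refine ⟨hx, ?_⟩
    rintro y hy z hz ⟨a, b, ha, hb, hab, rfl⟩
    have := hd (y - (a • y + b • z)) (fun v hv h => by
      have h1 := hy v hv
      have h2 := hz v hv
      rw [inner_sub_left, h]
      rw [inner_add_left, inner_smul_left, inner_smul_left] at h
      simp only [conj_trivial] at h
      have : a * (⟪y, v⟫ + 1) + b * (⟪z, v⟫ + 1) = 0 := by linear_combination h + hab
      have h3 : 0 ≤ a * (⟪y, v⟫ + 1) := mul_nonneg ha.le (by linarith)
      have h4 : 0 ≤ b * (⟪z, v⟫ + 1) := mul_nonneg hb.le (by linarith)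
      have h5 : a * (⟪y, v⟫ + 1) = 0 := by linarith
      have h6 := (mul_eq_zero.mp h5).resolve_left ha.ne'
      linarith)
    exact sub_eq_zero.mp this

lemma inner_ee (x : E10) (i : Fin 10) : ⟪x, ee i⟫ = x i := by
  simp [ee, EuclideanSpace.inner_single_right]

lemma mem_P (x : E10) : x ∈ P ↔
    (0 ≤ x 0 + 1 ∧ 0 ≤ x 1 + 1 ∧ 0 ≤ x 2 + 1 ∧ 0 ≤ x 3 + 1 ∧ x 0 + x 1 + x 2 + x 3 ≤ 1) ∧
    (0 ≤ x 4 + 1 ∧ 0 ≤ x 5 + 1 ∧ 0 ≤ x 6 + 1 ∧ 0 ≤ x 7 + 1 ∧ x 4 + x 5 + x 6 + x 7 ≤ 1) ∧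
    (0 ≤ x 8 + 1 ∧ x 8 ≤ 1 ∧ 0 ≤ x 9 + 1 ∧ x 9 ≤ 1) ∧
    (0 ≤ x 0 + x 4 + 1 ∧ 0 ≤ x 0 + x 4 + x 8 + 1 ∧ 0 ≤ x 1 + x 5 + 1 ∧
      0 ≤ x 1 + x 5 + x 9 + 1) := by
  simp only [P, V18, Set.mem_ofPred_eq, Set.mem_insert_iff, Set.mem_singleton_iff,
    forall_eq_or_imp, forall_eq, inner_add_right, inner_neg_right, inner_ee]
  constructor
  · rintro ⟨h0, h1, h2, h3, h4, h5, h6, h7, h8, h9, h10, h11, h12, h13, h14, h15, h16, h17⟩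
    refine ⟨⟨?_, ?_, ?_, ?_, ?_⟩, ⟨?_, ?_, ?_, ?_, ?_⟩, ⟨?_, ?_, ?_, ?_⟩, ?_, ?_, ?_, ?_⟩ <;>
      linarith
  · rintro ⟨⟨h0, h1, h2, h3, h4⟩, ⟨h5, h6, h7, h8, h9⟩, ⟨h10, h11, h12, h13⟩,
      h14, h15, h16, h17⟩
    refine ⟨?_, ?_, ?_, ?_, ?_, ?_, ?_, ?_, ?_, ?_, ?_, ?_, ?_, ?_, ?_, ?_, ?_, ?_⟩ <;> linarith

/-- `d` is orthogonal to every facet normal that is tight at `x`. -/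
def Tight (x d : E10) : Prop :=
  ((x 0 = -1 → d 0 = 0) ∧ (x 1 = -1 → d 1 = 0) ∧ (x 2 = -1 → d 2 = 0) ∧ (x 3 = -1 → d 3 = 0) ∧
    (x 0 + x 1 + x 2 + x 3 = 1 → d 0 + d 1 + d 2 + d 3 = 0)) ∧
  ((x 4 = -1 → d 4 = 0) ∧ (x 5 = -1 → d 5 = 0) ∧ (x 6 = -1 → d 6 = 0) ∧ (x 7 = -1 → d 7 = 0) ∧
    (x 4 + x 5 + x 6 + x 7 = 1 → d 4 + d 5 + d 6 + d 7 = 0)) ∧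
  ((x 8 = -1 → d 8 = 0) ∧ (x 8 = 1 → d 8 = 0) ∧ (x 9 = -1 → d 9 = 0) ∧ (x 9 = 1 → d 9 = 0)) ∧
  ((x 0 + x 4 = -1 → d 0 + d 4 = 0) ∧ (x 0 + x 4 + x 8 = -1 → d 0 + d 4 + d 8 = 0) ∧
    (x 1 + x 5 = -1 → d 1 + d 5 = 0) ∧ (x 1 + x 5 + x 9 = -1 → d 1 + d 5 + d 9 = 0))

lemma tight_iff (x d : E10) : (∀ v ∈ V18, ⟪x, v⟫ = -1 → ⟪d, v⟫ = 0) ↔ Tight x d := by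
  simp only [Tight, V18, Set.mem_insert_iff, Set.mem_singleton_iff,
    forall_eq_or_imp, forall_eq, inner_add_right, inner_neg_right, inner_ee, neg_inj, neg_eq_zero]
  have e8 : -x 8 = -1 ↔ x 8 = 1 := neg_inj
  have e : ∀ a : ℝ, a = 1 ↔ -a = -1 := fun a => neg_inj.symm
  tauto

/-- One triangle of slack coordinates: at most one can be nonzero. -/
lemma ext_iff' (x : E10) : x ∈ Set.extremePoints ℝ P ↔
    x ∈ P ∧ ∀ d : E10, Tight x d → d = 0 := by
  rw [ext_iff]
  simp only [tight_iff]

def mk (d0 d1 d2 d3 d4 d5 d6 d7 d8 d9 : ℝ) : E10 :=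
  WithLp.toLp 2 ![d0, d1, d2, d3, d4, d5, d6, d7, d8, d9]

section
variable (d0 d1 d2 d3 d4 d5 d6 d7 d8 d9 : ℝ)
@[simp] lemma mk0 : mk d0 d1 d2 d3 d4 d5 d6 d7 d8 d9 0 = d0 := rfl
@[simp] lemma mk1 : mk d0 d1 d2 d3 d4 d5 d6 d7 d8 d9 1 = d1 := rfl
@[simp] lemma mk2 : mk d0 d1 d2 d3 d4 d5 d6 d7 d8 d9 2 = d2 := rfl
@[simp] lemma mk3 : mk d0 d1 d2 d3 d4 d5 d6 d7 d8 d9 3 = d3 := rfl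
@[simp] lemma mk4 : mk d0 d1 d2 d3 d4 d5 d6 d7 d8 d9 4 = d4 := rfl
@[simp] lemma mk5 : mk d0 d1 d2 d3 d4 d5 d6 d7 d8 d9 5 = d5 := rfl
@[simp] lemma mk6 : mk d0 d1 d2 d3 d4 d5 d6 d7 d8 d9 6 = d6 := rfl
@[simp] lemma mk7 : mk d0 d1 d2 d3 d4 d5 d6 d7 d8 d9 7 = d7 := rfl
@[simp] lemma mk8 : mk d0 d1 d2 d3 d4 d5 d6 d7 d8 d9 8 = d8 := rfl
@[simp] lemma mk9 : mk d0 d1 d2 d3 d4 d5 d6 d7 d8 d9 9 = d9 := rfl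
end

lemma mk_eta (x : E10) : x = mk (x 0) (x 1) (x 2) (x 3) (x 4) (x 5) (x 6) (x 7) (x 8) (x 9) := by
  ext i; fin_cases i <;> rfl

lemma mk_eq_zero {d0 d1 d2 d3 d4 d5 d6 d7 d8 d9 : ℝ} (h : mk d0 d1 d2 d3 d4 d5 d6 d7 d8 d9 = 0) :
    d0 = 0 ∧ d1 = 0 ∧ d2 = 0 ∧ d3 = 0 ∧ d4 = 0 ∧ d5 = 0 ∧ d6 = 0 ∧ d7 = 0 ∧ d8 = 0 ∧ d9 = 0 :=
  ⟨congrArg (fun z : E10 => z 0) h, congrArg (fun z : E10 => z 1) h,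
   congrArg (fun z : E10 => z 2) h, congrArg (fun z : E10 => z 3) h,
   congrArg (fun z : E10 => z 4) h, congrArg (fun z : E10 => z 5) h,
   congrArg (fun z : E10 => z 6) h, congrArg (fun z : E10 => z 7) h,
   congrArg (fun z : E10 => z 8) h, congrArg (fun z : E10 => z 9) h⟩

/-- The slack coordinates at an extreme point. -/
lemma slack (x : E10) (hx : x ∈ Set.extremePoints ℝ P) :
    ((x 2 = -1 ∨ x 3 = -1) ∧ (x 2 = -1 ∨ x 0 + x 1 + x 2 + x 3 = 1) ∧
      (x 3 = -1 ∨ x 0 + x 1 + x 2 + x 3 = 1)) ∧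
    ((x 6 = -1 ∨ x 7 = -1) ∧ (x 6 = -1 ∨ x 4 + x 5 + x 6 + x 7 = 1) ∧
      (x 7 = -1 ∨ x 4 + x 5 + x 6 + x 7 = 1)) ∧
    (x 8 = -1 ∨ x 8 = 1 ∨ x 0 + x 4 + x 8 = -1) ∧
    (x 9 = -1 ∨ x 9 = 1 ∨ x 1 + x 5 + x 9 = -1) := by
  obtain ⟨hP, hd⟩ := (ext_iff' x).1 hx
  refine ⟨⟨?_, ?_, ?_⟩, ⟨?_, ?_, ?_⟩, ?_, ?_⟩ <;> by_contra! hcon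
  · simpa using mk_eq_zero (hd (mk 0 0 1 (-1) 0 0 0 0 0 0) (by simp [Tight, hcon]))
  · simpa using mk_eq_zero (hd (mk 0 0 1 0 0 0 0 0 0 0) (by simp [Tight, hcon]))
  · simpa using mk_eq_zero (hd (mk 0 0 0 1 0 0 0 0 0 0) (by simp [Tight, hcon]))
  · simpa using mk_eq_zero (hd (mk 0 0 0 0 0 0 1 (-1) 0 0) (by simp [Tight, hcon]))
  · simpa using mk_eq_zero (hd (mk 0 0 0 0 0 0 1 0 0 0) (by simp [Tight, hcon]))
  · simpa using mk_eq_zero (hd (mk 0 0 0 0 0 0 0 1 0 0) (by simp [Tight, hcon]))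
  · simpa using mk_eq_zero (hd (mk 0 0 0 0 0 0 0 0 1 0) (by simp [Tight, hcon]))
  · simpa using mk_eq_zero (hd (mk 0 0 0 0 0 0 0 0 0 1) (by simp [Tight, hcon]))

/-- The reduced four-variable rank condition at an extreme point. -/
lemma reduced (x : E10) (hx : x ∈ Set.extremePoints ℝ P) (g0 g1 g4 g5 : ℝ)
    (h0 : x 0 = -1 → g0 = 0) (h1 : x 1 = -1 → g1 = 0)
    (h4 : x 4 = -1 → g4 = 0) (h5 : x 5 = -1 → g5 = 0)
    (hA : x 0 + x 1 = 3 → g0 + g1 = 0) (hB : x 4 + x 5 = 3 → g4 + g5 = 0)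
    (hC : x 0 + x 4 = -1 → g0 + g4 = 0) (hC' : x 0 + x 4 = 0 → x 8 = -1 → g0 + g4 = 0)
    (hD : x 1 + x 5 = -1 → g1 + g5 = 0) (hD' : x 1 + x 5 = 0 → x 9 = -1 → g1 + g5 = 0) :
    g0 = 0 ∧ g1 = 0 ∧ g4 = 0 ∧ g5 = 0 := by
  obtain ⟨hP, hd⟩ := (ext_iff' x).1 hx
  obtain ⟨⟨s1, s2, s3⟩, ⟨s4, s5, s6⟩, s7, s8⟩ := slack x hx
  obtain ⟨⟨p0, p1, p2, p3, p4⟩, ⟨p5, p6, p7, p8, p9⟩, ⟨p10, p11, p12, p13⟩,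
      p14, p15, p16, p17⟩ := (mem_P x).1 hP
  have key : ∀ x0 x1 x2 x3 g : ℝ, (x2 = -1 ∨ x3 = -1) →
      (x0 + x1 = 3 → g = 0) →
      ∃ d2 d3 : ℝ, (x2 = -1 → d2 = 0) ∧ (x3 = -1 → d3 = 0) ∧
        (x0 + x1 + x2 + x3 = 1 → g + d2 + d3 = 0) := by
    intro x0 x1 x2 x3 g s h
    by_cases e2 : x2 = -1
    · by_cases e3 : x3 = -1
      · exact ⟨0, 0, by simp, by simp, fun e => by rw [h (by linarith)]; simp⟩
      · exact ⟨0, -g, by simp, by simp [e3], fun e => by ring⟩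
    · exact ⟨-g, 0, by simp [e2], by simp, fun e => by ring⟩
  have key2 : ∀ p s g : ℝ, 0 ≤ p + 1 → (p = 0 → s = -1 → g = 0) → 
      ∃ d : ℝ, (s = -1 → d = 0) ∧ (s = 1 → d = 0) ∧ (p + s = -1 → g + d = 0) := by
    intro p s g hp h
    by_cases e1 : s = -1
    · exact ⟨0, by simp, by simp, fun e => by rw [h (by linarith) e1]; simp⟩
    · by_cases e2 : s = 1
      · exact ⟨0, by simp, by simp, fun e => by linarith⟩
      · exact ⟨-g, by simp [e1], by simp [e2], fun e => by ring⟩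
  obtain ⟨d2, d3, a1, a2, a3⟩ := key (x 0) (x 1) (x 2) (x 3) (g0 + g1) s1 hA
  obtain ⟨d6, d7, b1, b2, b3⟩ := key (x 4) (x 5) (x 6) (x 7) (g4 + g5) s4 hB
  obtain ⟨d8, c1, c2, c3⟩ := key2 (x 0 + x 4) (x 8) (g0 + g4) p14 hC'
  obtain ⟨d9, c4, c5, c6⟩ := key2 (x 1 + x 5) (x 9) (g1 + g5) p16 hD'
  have := mk_eq_zero (hd (mk g0 g1 d2 d3 g4 g5 d6 d7 d8 d9) (by
    simp only [Tight, mk0, mk1, mk2, mk3, mk4, mk5, mk6, mk7, mk8, mk9]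
    exact ⟨⟨h0, h1, a1, a2, a3⟩, ⟨h4, h5, b1, b2, b3⟩, ⟨c1, c2, c4, c5⟩, hC, c3, hD, c6⟩))
  exact ⟨this.1, this.2.1, this.2.2.2.2.1, this.2.2.2.2.2.1⟩

def IsZ (r : ℝ) : Prop := ∃ m : ℤ, r = m

lemma IsZ.of_add {a b : ℝ} (ha : IsZ a) (h : ∃ k : ℤ, a + b = k) : IsZ b := by
  obtain ⟨m, rfl⟩ := ha
  obtain ⟨k, hk⟩ := h
  exact ⟨k - m, by push_cast; linarith⟩

lemma integral4 (x : E10) (hx : x ∈ Set.extremePoints ℝ P) :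
    IsZ (x 0) ∧ IsZ (x 1) ∧ IsZ (x 4) ∧ IsZ (x 5) := by
  classical
  have hm : ∀ (r e : ℝ), r = -1 → (if IsZ r then (0 : ℝ) else e) = 0 := by
    intro r e h
    rw [if_pos ⟨-1, by simp [h]⟩]
  have he : ∀ (a b : ℝ) (k : ℤ) (e : ℝ), a + b = k →
      (if IsZ a then (0 : ℝ) else e) + (if IsZ b then (0 : ℝ) else -e) = 0 := by
    intro a b k e h
    by_cases ha : IsZ a
    · have hb : IsZ b := IsZ.of_add ha ⟨k, h⟩
      simp [ha, hb]
    · have hb : ¬ IsZ b := fun hb => ha (IsZ.of_add hb ⟨k, by linarith⟩)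
      simp [ha, hb]
  have he' : ∀ (a b : ℝ) (k : ℤ), a + b = k →
      (if IsZ a then (0 : ℝ) else -1) + (if IsZ b then (0 : ℝ) else 1) = 0 := by
    intro a b k h
    have := he a b k (-1) h
    rwa [neg_neg] at this
  have := reduced x hx (if IsZ (x 0) then 0 else 1) (if IsZ (x 1) then 0 else -1)
    (if IsZ (x 4) then 0 else -1) (if IsZ (x 5) then 0 else 1)
    (hm _ _) (hm _ _) (hm _ _) (hm _ _)
    (fun h => he _ _ 3 1 (by simp [h])) (fun h => he' _ _ 3 (by simp [h]))
    (fun h => he _ _ (-1) 1 (by simp [h])) (fun h _ => he _ _ 0 1 (by simp [h]))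
    (fun h => he' _ _ (-1) (by simp [h])) (fun h _ => he' _ _ 0 (by simp [h]))
  simpa using this

/-- Combinatorial condition on a subset of the four cycle variables. -/
def cutBody (a b c d s t : ℕ) (A B C D : Bool) : Bool :=
  !(A || B || C || D) || (A && a == 0) || (B && b == 0) || (C && c == 0) || (D && d == 0) ||
    ((A ^^ B) && a + b == 5) || ((C ^^ D) && c + d == 5) ||
    ((A ^^ C) && (a + c == 1 || (a + c == 2 && s == 0))) ||
    ((B ^^ D) && (b + d == 1 || (b + d == 2 && t == 0)))

def cut (a b c d s t : ℕ) : Bool :=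
  [true, false].all fun A => [true, false].all fun B => [true, false].all fun C =>
    [true, false].all fun D => cutBody a b c d s t A B C D

lemma cut_iff (a b c d s t : ℕ) :
    cut a b c d s t = true ↔ ∀ A B C D, cutBody a b c d s t A B C D = true := by
  have : ∀ p : Bool → Bool, [true, false].all p = true ↔ ∀ A, p A = true := by
    intro p
    simp [Bool.forall_bool, and_comm]
  unfold cut
  simp only [this]

def opts (r : ℕ) : List (ℕ × ℕ) := if r == 0 then [(0, 0)] else [(0, 0), (0, r), (r, 0)]

def sopts (p : ℕ) : List ℕ :=
  [0, 1, 2].filter fun s => Nat.ble 2 (p + s) && (s == 0 || s == 2 || p + s == 2)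

/-- All vertices, shifted to natural coordinates. -/
def verts : List (ℕ × ℕ × ℕ × ℕ × ℕ × ℕ × (ℕ × ℕ) × (ℕ × ℕ)) :=
  (List.range 6).flatMap fun a => (List.range (6 - a)).flatMap fun b =>
  (List.range 6).flatMap fun c => if a + c == 0 then [] else
  (List.range (6 - c)).flatMap fun d => if b + d == 0 then [] else
  (sopts (a + c)).flatMap fun s => (sopts (b + d)).flatMap fun t =>
  if cut a b c d s t then
    (opts (5 - a - b)).flatMap fun u => (opts (5 - c - d)).map fun v => (a, b, c, d, s, t, u, v)
  else []

lemma verts_length : verts.length = 500 := by decide +kernel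

def code : ℕ × ℕ × ℕ × ℕ × ℕ × ℕ × (ℕ × ℕ) × (ℕ × ℕ) → ℕ
  | (a, b, c, d, s, t, u, v) =>
    v.2 + 6 * (v.1 + 6 * (u.2 + 6 * (u.1 + 6 * (t + 6 * (s + 6 * (d + 6 * (c + 6 * (b + 6 * a))))))))

def incr : List ℕ → Bool
  | [] => true
  | [_] => true
  | a :: b :: l => Nat.blt a b && incr (b :: l)

lemma incr_chain : ∀ l : List ℕ, incr l = true → l.IsChain (· < ·)
  | [], _ => by simp
  | [_], _ => by simp
  | a :: b :: l, h => by
    simp only [incr, Bool.and_eq_true, Nat.blt_eq] at h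
    exact List.isChain_cons_cons.2 ⟨h.1, incr_chain _ h.2⟩

lemma verts_incr : incr (verts.map code) = true := by decide +kernel

lemma verts_nodup : verts.Nodup := by
  have h := (List.isChain_iff_pairwise.1 (incr_chain _ verts_incr))
  have h2 : (verts.map code).Nodup := h.imp fun h => ne_of_lt h
  exact h2.of_map

lemma mem_opts (r m n : ℕ) : (m, n) ∈ opts r ↔ (m = 0 ∧ n = 0) ∨ (m = 0 ∧ n = r) ∨
    (m = r ∧ n = 0) := by
  unfold opts
  split_ifs with h
  · simp only [beq_iff_eq] at h
    subst h
    simp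
  · simp

lemma mem_sopts (p s : ℕ) : s ∈ sopts p ↔ 2 ≤ p + s ∧ (s = 0 ∨ s = 2 ∨ (s ≤ 2 ∧ p + s = 2)) := by
  simp only [sopts, List.mem_filter, List.mem_cons, List.not_mem_nil, or_false, Bool.and_eq_true,
    Bool.or_eq_true, beq_iff_eq, Nat.ble_eq]
  omega

lemma mem_verts (a b c d s t u1 u2 v1 v2 : ℕ) :
    (a, b, c, d, s, t, (u1, u2), (v1, v2)) ∈ verts ↔
      a + b ≤ 5 ∧ c + d ≤ 5 ∧ a + c ≠ 0 ∧ b + d ≠ 0 ∧ s ∈ sopts (a + c) ∧ t ∈ sopts (b + d) ∧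
      cut a b c d s t = true ∧ (u1, u2) ∈ opts (5 - a - b) ∧ (v1, v2) ∈ opts (5 - c - d) := by
  unfold verts
  simp only [List.mem_flatMap, List.mem_ite_nil_left, List.mem_ite_nil_right, List.mem_map,
    List.mem_range, beq_iff_eq, Prod.mk.injEq]
  constructor
  · rintro ⟨a, ha, b, hb, c, hc, h1, d, hd, h2, s, hs, t, ht, h3, ⟨u1, u2⟩, hu, ⟨v1, v2⟩, hv, h⟩
    simp only [Prod.mk.injEq] at h
    obtain ⟨rfl, rfl, rfl, rfl, rfl, rfl, ⟨rfl, rfl⟩, rfl, rfl⟩ := h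
    exact ⟨by omega, by omega, h1, h2, hs, ht, h3, hu, hv⟩
  · rintro ⟨h1, h2, h3, h4, hs, ht, h5, hu, hv⟩
    exact ⟨a, by omega, b, by omega, c, by omega, h3, d, by omega, h4, s, hs, t, ht, h5,
      (u1, u2), hu, (v1, v2), hv, by simp⟩

/-- The vertex with given shifted coordinates. -/
def pt : ℕ × ℕ × ℕ × ℕ × ℕ × ℕ × (ℕ × ℕ) × (ℕ × ℕ) → E10
  | (a, b, c, d, s, t, (u1, u2), (v1, v2)) =>
    mk (a - 1) (b - 1) (u1 - 1) (u2 - 1) (c - 1) (d - 1) (v1 - 1) (v2 - 1) (s - 1) (t - 1)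

lemma pt_inj : Function.Injective pt := by
  rintro ⟨a, b, c, d, s, t, ⟨u1, u2⟩, ⟨v1, v2⟩⟩ ⟨a', b', c', d', s', t', ⟨u1', u2'⟩, ⟨v1', v2'⟩⟩ h
  have e : ∀ i, pt (a, b, c, d, s, t, (u1, u2), (v1, v2)) i =
    pt (a', b', c', d', s', t', (u1', u2'), (v1', v2')) i := fun i => by rw [h]
  have e0 := e 0
  have e1 := e 1
  have e2 := e 2
  have e3 := e 3
  have e4 := e 4
  have e5 := e 5
  have e6 := e 6
  have e7 := e 7
  have e8 := e 8
  have e9 := e 9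
  simp only [pt, mk0, mk1, mk2, mk3, mk4, mk5, mk6, mk7, mk8, mk9, sub_left_inj,
    Nat.cast_inj] at e0 e1 e2 e3 e4 e5 e6 e7 e8 e9
  simp [*]

lemma nat_of_isZ {r : ℝ} (h : IsZ r) (h0 : 0 ≤ r + 1) : ∃ n : ℕ, r = n - 1 := by
  obtain ⟨m, rfl⟩ := h
  have : 0 ≤ m + 1 := by exact_mod_cast h0
  refine ⟨(m + 1).toNat, ?_⟩
  have h2 : (((m + 1).toNat : ℤ) : ℝ) = ((m + 1 : ℤ) : ℝ) := by rw [Int.toNat_of_nonneg this]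
  push_cast at h2
  linarith

/-- Natural slack coordinates. -/
lemma slack_nat (a b : ℕ) (x y : ℝ) (hx : 0 ≤ x + 1) (hy : 0 ≤ y + 1)
    (h : (a - 1 : ℝ) + (b - 1) + x + y ≤ 1)
    (h1 : x = -1 ∨ y = -1) (h2 : x = -1 ∨ (a - 1 : ℝ) + (b - 1) + x + y = 1)
    (h3 : y = -1 ∨ (a - 1 : ℝ) + (b - 1) + x + y = 1) :
    a + b ≤ 5 ∧ ∃ m n : ℕ, x = m - 1 ∧ y = n - 1 ∧ (m, n) ∈ opts (5 - a - b) := by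
  have hab : a + b ≤ 5 := by
    have : (a : ℝ) + b ≤ 5 := by linarith
    exact_mod_cast this
  have hc : ((5 - a - b : ℕ) : ℝ) = 5 - a - b := by
    rw [Nat.cast_sub (by omega), Nat.cast_sub (by omega)]
    simp
  refine ⟨hab, ?_⟩
  simp only [mem_opts]
  by_cases ex : x = -1
  · by_cases ey : y = -1
    · exact ⟨0, 0, by simp [ex], by simp [ey], by simp⟩
    · have := h3.resolve_left ey
      exact ⟨0, 5 - a - b, by simp [ex], by rw [hc]; linarith, by simp⟩
  · have := h2.resolve_left ex
    have ey := h1.resolve_left ex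
    exact ⟨5 - a - b, 0, by rw [hc]; linarith, by simp [ey], by simp⟩

lemma s_nat (a c : ℕ) (s : ℝ) (h0 : 0 ≤ s + 1) (h1 : s ≤ 1) 
    (hp : 0 ≤ (a - 1 : ℝ) + (c - 1) + 1) (hps : 0 ≤ (a - 1 : ℝ) + (c - 1) + s + 1)
    (h : s = -1 ∨ s = 1 ∨ (a - 1 : ℝ) + (c - 1) + s = -1) :
    a + c ≠ 0 ∧ ∃ n : ℕ, s = n - 1 ∧ n ∈ sopts (a + c) := by
  have hac : 1 ≤ a + c := by
    have : (1 : ℝ) ≤ a + c := by linarith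
    exact_mod_cast this
  have hz : IsZ s := by
    rcases h with h | h | h
    · exact ⟨-1, by simp [h]⟩
    · exact ⟨1, by simp [h]⟩
    · exact ⟨1 - a - c, by push_cast; linarith⟩
  obtain ⟨n, rfl⟩ := nat_of_isZ hz h0
  refine ⟨by omega, n, rfl, ?_⟩
  rw [mem_sopts]
  have hn : n ≤ 2 := by
    have : (n : ℝ) ≤ 2 := by linarith
    exact_mod_cast this
  have hs : 2 ≤ a + c + n := by
    have : (2 : ℝ) ≤ a + c + n := by linarith
    exact_mod_cast this
  refine ⟨hs, ?_⟩
  rcases h with h | h | h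
  · left
    have : (n : ℝ) = 0 := by linarith
    exact_mod_cast this
  · right; left
    have : (n : ℝ) = 2 := by linarith
    exact_mod_cast this
  · right; right
    refine ⟨hn, ?_⟩
    have : (a + c + n : ℝ) = 2 := by linarith
    exact_mod_cast this

lemma cast_sum {a b : ℕ} {k : ℝ} (m : ℕ) (h : (a - 1 : ℝ) + (b - 1) = k) (hk : k + 2 = m) :
    a + b = m := by
  have : (a + b : ℝ) = m := by linarith
  exact_mod_cast this

lemma f2 (X Y : Bool) (p : Prop) (e e' : ℝ) (he : e + e' = 0) (h : ¬ ((X ^^ Y) = true ∧ p))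
    (hp : p) : (if X = true then e else 0) + (if Y = true then e' else 0) = 0 := by
  have h2 : ¬ (X ^^ Y) = true := fun hX => h ⟨hX, hp⟩
  clear h
  cases X <;> cases Y
  · simp
  · exact absurd rfl h2
  · exact absurd rfl h2
  · simpa using he

lemma f3 (X : Bool) (e : ℝ) (he : e ≠ 0) (h : (if X = true then e else 0) = 0) : X = false := by
  cases X
  · rfl
  · exact absurd h (by simpa using he)

lemma cutBody_of (a b c d s t : ℕ) (A B C D : Bool)
    (H : ∀ g0 g1 g4 g5 : ℝ, (a = 0 → g0 = 0) → (b = 0 → g1 = 0) → (c = 0 → g4 = 0) →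
        (d = 0 → g5 = 0) → (a + b = 5 → g0 + g1 = 0) → (c + d = 5 → g4 + g5 = 0) →
        (a + c = 1 → g0 + g4 = 0) → (a + c = 2 → s = 0 → g0 + g4 = 0) →
        (b + d = 1 → g1 + g5 = 0) → (b + d = 2 → t = 0 → g1 + g5 = 0) →
        g0 = 0 ∧ g1 = 0 ∧ g4 = 0 ∧ g5 = 0) : cutBody a b c d s t A B C D = true := by
  by_contra hcon
  simp only [cutBody, Bool.or_eq_true, Bool.and_eq_true, beq_iff_eq, not_or] at hcon
  obtain ⟨⟨⟨⟨⟨⟨⟨⟨k, k0⟩, k1⟩, k2⟩, k3⟩, k4⟩, k5⟩, k6⟩, k7⟩ := hcon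
  have f1 : ∀ (X : Bool) (n : ℕ) (e : ℝ), ¬ (X = true ∧ n = 0) → n = 0 →
      (if X = true then e else 0) = 0 := by
    intro X n e h hn
    rw [if_neg fun hX => h ⟨hX, hn⟩]
  have := H (if A then 1 else 0) (if B then -1 else 0) (if C then -1 else 0) (if D then 1 else 0)
    (f1 _ _ _ k0) (f1 _ _ _ k1) (f1 _ _ _ k2) (f1 _ _ _ k3)
    (f2 _ _ _ _ _ (by norm_num) k4) (f2 _ _ _ _ _ (by norm_num) k5)
    (fun h => f2 _ _ _ _ _ (by norm_num) k6 (Or.inl h))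
    (fun h h' => f2 _ _ _ _ _ (by norm_num) k6 (Or.inr ⟨h, h'⟩))
    (fun h => f2 _ _ _ _ _ (by norm_num) k7 (Or.inl h))
    (fun h h' => f2 _ _ _ _ _ (by norm_num) k7 (Or.inr ⟨h, h'⟩))
  apply k
  rw [f3 A _ (by norm_num) this.1, f3 B _ (by norm_num) this.2.1,
    f3 C _ (by norm_num) this.2.2.1, f3 D _ (by norm_num) this.2.2.2]
  rfl

lemma ext_sub (x : E10) (hx : x ∈ Set.extremePoints ℝ P) : ∃ q ∈ verts, pt q = x := by
  obtain ⟨⟨s1, s2, s3⟩, ⟨s4, s5, s6⟩, s7, s8⟩ := slack x hx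
  obtain ⟨⟨p0, p1, p2, p3, p4⟩, ⟨p5, p6, p7, p8, p9⟩, ⟨p10, p11, p12, p13⟩,
      p14, p15, p16, p17⟩ := (mem_P x).1 hx.1
  obtain ⟨i0, i1, i4, i5⟩ := integral4 x hx
  obtain ⟨a, ea⟩ := nat_of_isZ i0 p0
  obtain ⟨b, eb⟩ := nat_of_isZ i1 p1
  obtain ⟨c, ec⟩ := nat_of_isZ i4 p5
  obtain ⟨d, ed⟩ := nat_of_isZ i5 p6
  have hred := reduced x hx
  rw [ea, eb] at s2 s3 p4
  rw [ec, ed] at s5 s6 p9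
  rw [ea, ec] at s7 p14 p15
  rw [eb, ed] at s8 p16 p17
  obtain ⟨hab, u1, u2, eu1, eu2, hu⟩ := slack_nat a b _ _ p2 p3 p4 s1 s2 s3
  obtain ⟨hcd, v1, v2, ev1, ev2, hv⟩ := slack_nat c d _ _ p7 p8 p9 s4 s5 s6
  obtain ⟨hac, s, es, hs⟩ := s_nat a c _ p10 p11 p14 p15 s7
  obtain ⟨hbd, t, et, ht⟩ := s_nat b d _ p12 p13 p16 p17 s8
  refine ⟨(a, b, c, d, s, t, (u1, u2), (v1, v2)), ?_, ?_⟩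
  · rw [mem_verts]
    refine ⟨hab, hcd, hac, hbd, hs, ht, ?_, hu, hv⟩
    rw [cut_iff]
    intro A B C D
    have z : ∀ n : ℕ, (n - 1 : ℝ) = -1 → n = 0 := by
      intro n h
      have : (n : ℝ) = 0 := by linarith
      exact_mod_cast this
    rw [ea, eb, ec, ed, es, et] at hred
    apply cutBody_of
    have n1 : (3 : ℝ) + 2 = (5 : ℕ) := by norm_num
    have n2 : (-1 : ℝ) + 2 = (1 : ℕ) := by norm_num
    have n3 : (0 : ℝ) + 2 = (2 : ℕ) := by norm_num
    intro g0 g1 g4 g5 h1 h2 h3 h4 h5 h6 h7 h8 h9 h10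
    exact hred g0 g1 g4 g5 (fun h => h1 (z _ h)) (fun h => h2 (z _ h)) (fun h => h3 (z _ h))
        (fun h => h4 (z _ h)) (fun h => h5 (cast_sum 5 h n1)) (fun h => h6 (cast_sum 5 h n1))
        (fun h => h7 (cast_sum 1 h n2)) (fun h h' => h8 (cast_sum 2 h n3) (z _ h'))
        (fun h => h9 (cast_sum 1 h n2)) (fun h h' => h10 (cast_sum 2 h n3) (z _ h'))
  · rw [mk_eta x, ea, eb, ec, ed, es, et, eu1, eu2, ev1, ev2]
    rfl

lemma cut_zero {a b c d s t : ℕ} (h : cut a b c d s t = true) {g0 g1 g4 g5 : ℝ}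
    (h0 : a = 0 → g0 = 0) (h1 : b = 0 → g1 = 0) (h2 : c = 0 → g4 = 0)
    (h3 : d = 0 → g5 = 0) (h4 : a + b = 5 → g0 + g1 = 0) (h5 : c + d = 5 → g4 + g5 = 0)
    (h6 : a + c = 1 → g0 + g4 = 0) (h7 : a + c = 2 → s = 0 → g0 + g4 = 0)
    (h8 : b + d = 1 → g1 + g5 = 0) (h9 : b + d = 2 → t = 0 → g1 + g5 = 0) :
    g0 = 0 ∧ g1 = 0 ∧ g4 = 0 ∧ g5 = 0 := by
  classical
  have hx : ∀ u v : ℝ, u + v = 0 → (u = 0 ↔ v = 0) := by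
    intro u v h
    constructor <;> intro h' <;> linarith
  have hx' : ∀ u v : ℝ, u + v = 0 → (decide (u ≠ 0) ^^ decide (v ≠ 0)) = false := by
    intro u v h
    have := hx u v h
    by_cases hu : u = 0
    · simp [hu, this.1 hu]
    · have hv : v ≠ 0 := fun hv => hu (this.2 hv)
      simp [hu, hv]
  have hc := (cut_iff a b c d s t).1 h (decide (g0 ≠ 0)) (decide (g1 ≠ 0)) (decide (g4 ≠ 0))
    (decide (g5 ≠ 0))
  simp only [cutBody, Bool.or_eq_true, Bool.and_eq_true, beq_iff_eq] at hc
  rcases hc with ((((((((hc | hc) | hc) | hc) | hc) | hc) | hc) | hc) | hc)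
  · simpa [and_assoc] using hc
  · simp [h0 hc.2] at hc
  · simp [h1 hc.2] at hc
  · simp [h2 hc.2] at hc
  · simp [h3 hc.2] at hc
  · rw [hx' _ _ (h4 hc.2)] at hc
    simp at hc
  · rw [hx' _ _ (h5 hc.2)] at hc
    simp at hc
  · have : g0 + g4 = 0 := by
      rcases hc.2 with h | h
      · exact h6 h
      · exact h7 h.1 h.2
    rw [hx' _ _ this] at hc
    simp at hc
  · have : g1 + g5 = 0 := by
      rcases hc.2 with h | h
      · exact h8 h
      · exact h9 h.1 h.2
    rw [hx' _ _ this] at hc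
    simp at hc

/-- Facts on slack coordinates chosen by `opts`. -/
lemma opts_real {a b m n : ℕ} (hab : a + b ≤ 5) (h : (m, n) ∈ opts (5 - a - b)) :
    (a - 1 : ℝ) + (b - 1) + (m - 1) + (n - 1) ≤ 1 ∧
    ∀ g d2 d3 : ℝ, ((m - 1 : ℝ) = -1 → d2 = 0) → ((n - 1 : ℝ) = -1 → d3 = 0) →
      ((a - 1 : ℝ) + (b - 1) + (m - 1) + (n - 1) = 1 → g + d2 + d3 = 0) →
      (a + b = 5 → g = 0) ∧ (g = 0 → d2 = 0 ∧ d3 = 0) := by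
  rw [mem_opts] at h
  have hle : a + b + m + n ≤ 5 := by omega
  have hle' : (a + b + m + n : ℝ) ≤ 5 := by exact_mod_cast hle
  refine ⟨by linarith, ?_⟩
  intro g d2 d3 h2 h3 hs
  have k2 : m = 0 → d2 = 0 := fun e => h2 (by simp [e])
  have k3 : n = 0 → d3 = 0 := fun e => h3 (by simp [e])
  have ks : a + b + m + n = 5 → g + d2 + d3 = 0 := fun e => hs (by
    have : (a + b + m + n : ℝ) = 5 := by exact_mod_cast e
    linarith)
  constructor
  · intro e
    have := k2 (by omega)
    have := k3 (by omega)
    have := ks (by omega)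
    linarith
  · rintro rfl
    rcases h with h | h | h
    · exact ⟨k2 h.1, k3 h.2⟩
    · have := k2 h.1
      have := ks (by omega)
      exact ⟨by assumption, by linarith⟩
    · have := k3 h.2
      have := ks (by omega)
      exact ⟨by linarith, by assumption⟩

lemma sopts_real {a c s : ℕ} (hac : a + c ≠ 0) (h : s ∈ sopts (a + c)) :
    ((s - 1 : ℝ) ≤ 1 ∧ 0 ≤ (a - 1 : ℝ) + (c - 1) + 1 ∧
      0 ≤ (a - 1 : ℝ) + (c - 1) + (s - 1) + 1) ∧
    ∀ g d8 : ℝ, ((s - 1 : ℝ) = -1 → d8 = 0) → ((s - 1 : ℝ) = 1 → d8 = 0) →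
      ((a - 1 : ℝ) + (c - 1) = -1 → g = 0) →
      ((a - 1 : ℝ) + (c - 1) + (s - 1) = -1 → g + d8 = 0) →
      (a + c = 1 → g = 0) ∧ (a + c = 2 → s = 0 → g = 0) ∧ (g = 0 → d8 = 0) := by
  rw [mem_sopts] at h
  have hs : s ≤ 2 := by omega
  have hs' : (s : ℝ) ≤ 2 := by exact_mod_cast hs
  have hp : 1 ≤ a + c := by omega
  have hp' : (1 : ℝ) ≤ a + c := by exact_mod_cast hp
  have hq' : (2 : ℝ) ≤ a + c + s := by exact_mod_cast h.1
  refine ⟨⟨by linarith, by linarith, by linarith⟩, ?_⟩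
  intro g d8 h1 h2 h3 h4
  have k1 : s = 0 → d8 = 0 := fun e => h1 (by simp [e])
  have k2 : s = 2 → d8 = 0 := fun e => h2 (by rw [e]; norm_num)
  have k3 : a + c = 1 → g = 0 := fun e => h3 (by
    have : (a + c : ℝ) = 1 := by exact_mod_cast e
    linarith)
  have k4 : a + c + s = 2 → g + d8 = 0 := fun e => h4 (by
    have : (a + c + s : ℝ) = 2 := by exact_mod_cast e
    linarith)
  refine ⟨k3, fun e e' => ?_, ?_⟩
  · have := k1 e'
    have := k4 (by omega)
    linarith
  · rintro rfl
    rcases h.2 with h | h | h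
    · exact k1 h
    · exact k2 h
    · have := k4 h.2
      linarith

lemma pt_ext (q) (hq : q ∈ verts) : pt q ∈ Set.extremePoints ℝ P := by
  obtain ⟨a, b, c, d, s, t, ⟨u1, u2⟩, ⟨v1, v2⟩⟩ := q
  obtain ⟨hab, hcd, hac, hbd, hs, ht, hcut, hu, hv⟩ := (mem_verts ..).1 hq
  obtain ⟨A1, A2⟩ := opts_real hab hu
  obtain ⟨B1, B2⟩ := opts_real hcd hv
  obtain ⟨⟨C1, C2, C3⟩, C4⟩ := sopts_real hac hs
  obtain ⟨⟨D1, D2, D3⟩, D4⟩ := sopts_real hbd ht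
  rw [ext_iff', mem_P]
  simp only [Tight, pt, mk0, mk1, mk2, mk3, mk4, mk5, mk6, mk7, mk8, mk9, sub_add_cancel,
    Nat.cast_nonneg, true_and]
  refine ⟨⟨A1, B1, ⟨C1, D1⟩, by linarith, by linarith, by linarith, by linarith⟩, ?_⟩
  rintro g ⟨⟨t0, t1, t2, t3, t4⟩, ⟨t5, t6, t7, t8, t9⟩, ⟨t10, t11, t12, t13⟩, t14, t15, t16, t17⟩
  obtain ⟨a1, a2⟩ := A2 _ _ _ t2 t3 t4
  obtain ⟨b1, b2⟩ := B2 _ _ _ t7 t8 t9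
  obtain ⟨c1, c2, c3⟩ := C4 _ _ t10 t11 t14 t15
  obtain ⟨d1, d2, d3⟩ := D4 _ _ t12 t13 t16 t17
  obtain ⟨g0, g1, g4, g5⟩ := cut_zero hcut (fun e => t0 (by simp [e])) (fun e => t1 (by simp [e]))
    (fun e => t5 (by simp [e])) (fun e => t6 (by simp [e])) a1 b1 c1 c2 d1 d2
  obtain ⟨g2, g3⟩ := a2 (by linarith)
  obtain ⟨g6, g7⟩ := b2 (by linarith)
  have g8 := c3 (by linarith)
  have g9 := d3 (by linarith)
  ext i
  fin_cases i <;> assumption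

lemma ext_eq : Set.extremePoints ℝ P = Set.image pt {q | q ∈ verts} := by
  ext x
  constructor
  · intro h
    obtain ⟨q, hq, rfl⟩ := ext_sub x h
    exact ⟨q, hq, rfl⟩
  · rintro ⟨q, hq, rfl⟩
    exact pt_ext q hq

lemma P_convex : Convex ℝ P := by
  intro x hx y hy a b ha hb hab v hv
  have h1 := hx v hv
  have h2 := hy v hv
  rw [inner_add_left, inner_smul_left, inner_smul_left]
  simp only [conj_trivial]
  nlinarith [mul_nonneg ha (by linarith : 0 ≤ ⟪x, v⟫ + 1),
    mul_nonneg hb (by linarith : 0 ≤ ⟪y, v⟫ + 1)]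

lemma P_closed : IsClosed P := by
  have : P = ⋂ v ∈ V18, {x : E10 | -1 ≤ ⟪x, v⟫} := by
    ext x
    simp [P]
  rw [this]
  exact isClosed_biInter fun v _ => isClosed_le continuous_const (by fun_prop)

lemma P_bounded : Bornology.IsBounded P := by
  rw [isBounded_iff_forall_norm_le]
  refine ⟨√(10 * 16), fun x hx => ?_⟩
  obtain ⟨⟨p0, p1, p2, p3, p4⟩, ⟨p5, p6, p7, p8, p9⟩, ⟨p10, p11, p12, p13⟩, -⟩ := (mem_P x).1 hx
  have hb : ∀ i, -4 ≤ x i ∧ x i ≤ 4 := by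
    intro i
    fin_cases i <;> simp only [Fin.reduceFinMk, Fin.zero_eta, Fin.mk_one] <;>
      constructor <;> linarith
  rw [EuclideanSpace.norm_eq]
  apply Real.sqrt_le_sqrt
  calc ∑ i, ‖x i‖ ^ 2 ≤ ∑ i : Fin 10, (16 : ℝ) := by
        apply Finset.sum_le_sum
        intro i _
        rw [Real.norm_eq_abs, sq_abs]
        nlinarith [(hb i).1, (hb i).2]
    _ = 10 * 16 := by simp

lemma P_compact : IsCompact P := Metric.isCompact_of_isClosed_isBounded P_closed P_bounded

/-- `P` is a compact convex polytope, every extreme point of `P` lies in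
`ℤ¹⁰`, and `P` has exactly 500 extreme points. -/
theorem stmt8 :
    IsCompact P ∧ Convex ℝ P ∧
    (∃ S : Finset (EuclideanSpace ℝ (Fin 10)),
      P = convexHull ℝ (S : Set (EuclideanSpace ℝ (Fin 10)))) ∧
    (∀ x ∈ Set.extremePoints ℝ P, ∀ i : Fin 10, ∃ m : ℤ, x i = (m : ℝ)) ∧
    (Set.extremePoints ℝ P).ncard = 500 := by
  classical
  have hset : Set.extremePoints ℝ P = ((verts.toFinset.image pt : Finset E10) : Set E10) := by
    rw [ext_eq]
    ext x
    simp
  refine ⟨P_compact, P_convex, ⟨verts.toFinset.image pt, ?_⟩, ?_, ?_⟩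
  · rw [← closure_convexHull_extremePoints P_compact P_convex, hset]
    exact (Set.Finite.isClosed_convexHull ℝ (Finset.finite_toSet _)).closure_eq
  · intro x hx i
    obtain ⟨⟨a, b, c, d, s, t, ⟨u1, u2⟩, ⟨v1, v2⟩⟩, -, rfl⟩ := ext_sub x hx
    have : ∀ n : ℕ, ∃ m : ℤ, (n - 1 : ℝ) = m := fun n => ⟨n - 1, by push_cast; ring⟩
    fin_cases i <;> exact this _
  · rw [hset, Set.ncard_coe_finset, Finset.card_image_of_injective _ pt_inj,
      List.toFinset_card_of_nodup verts_nodup, verts_length]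
end
end

section
/- Let V ⊂ ℝ¹⁰ be the set of 18 points e₁, e₂, e₃, e₄, −(e₁+e₂+e₃+e₄), e₅, e₆, e₇, e₈, −(e₅+e₆+e₇+e₈), e₉, −e₉, e₁₀, −e₁₀, e₁+e₅, e₁+e₅+e₉, e₂+e₆, e₂+e₆+e₁₀, and define P = {x ∈ ℝ¹⁰ : ⟨x, v⟩ ≥ −1 for every v ∈ V}. Then the 10-dimensional Lebesgue measure of P equals 1160242379/907200. -/
noncomputable section

open MeasureTheory
open scoped RealInnerProductSpace

def ph (m : ℕ) (s : ℝ) : ℝ := if 0 < s then s ^ m else 0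
def KK (j m : ℕ) : ℝ := (j.factorial * m.factorial : ℝ) / ((j + m + 1).factorial : ℝ)

lemma ph_meas (m : ℕ) : Measurable (ph m) :=
  Measurable.ite measurableSet_Ioi (by fun_prop) (by fun_prop)
lemma ph_nonneg (m : ℕ) (s : ℝ) : 0 ≤ ph m s := by
  unfold ph; split_ifs <;> positivity
lemma ph_bd (m : ℕ) (s : ℝ) (h : s ≤ 5) : |ph m s| ≤ 5 ^ m := by
  rw [abs_of_nonneg (ph_nonneg m s)]; unfold ph; split_ifs
  · gcongr
  · positivity

lemma beta (c : ℝ) (j : ℕ) : ∀ m : ℕ, ∫ b in (0:ℝ)..c, (c - b) ^ m * b ^ j = KK j m * c ^ (j + m + 1) := by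
  induction j with
  | zero =>
    intro m
    simp only [pow_zero, mul_one]
    rw [intervalIntegral.integral_comp_sub_left (fun x => x ^ m) c]
    simp [KK, Nat.factorial_succ]
    field_simp
  | succ j ih =>
    intro m
    have h := intervalIntegral.integral_mul_deriv_eq_deriv_mul (a := 0) (b := c)
      (u := fun b : ℝ => b ^ (j+1)) (u' := fun b => (j+1 : ℝ) * b ^ j)
      (v := fun b : ℝ => -(c - b) ^ (m+1) / (m+1)) (v' := fun b => (c - b) ^ m)
      (fun x _ => by simpa using hasDerivAt_pow (j+1) x)
      (fun x _ => by
        have h0 : HasDerivAt (fun b : ℝ => c - b) (-1) x := by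
          simpa using (hasDerivAt_id x).const_sub c
        have h1 : HasDerivAt (fun b : ℝ => -(c - b) ^ (m+1) / (m+1))
            (-(((m+1 : ℕ) : ℝ) * (c - x) ^ m * (-1)) / (m+1)) x :=
          (h0.fun_pow (m+1)).fun_neg.div_const (m+1 : ℝ)
        have h2 : (m + 1 : ℝ) ≠ 0 := by positivity
        have h3 : -(((m+1 : ℕ) : ℝ) * (c - x) ^ m * (-1)) / (m+1) = (c - x) ^ m := by
          push_cast
          field_simp
        rw [h3] at h1
        exact h1)
      (Continuous.intervalIntegrable (by fun_prop) _ _)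
      (Continuous.intervalIntegrable (by fun_prop) _ _)
    have e1 : ∫ b in (0:ℝ)..c, (c - b) ^ m * b ^ (j+1) = ∫ b in (0:ℝ)..c, b ^ (j+1) * (c - b) ^ m := by
      congr 1; ext b; ring
    have e2 : ∫ b in (0:ℝ)..c, (j+1 : ℝ) * b ^ j * (-(c - b) ^ (m+1) / (m+1))
       = -((j+1 : ℝ) / (m+1)) * ∫ b in (0:ℝ)..c, (c - b) ^ (m+1) * b ^ j := by
      rw [← intervalIntegral.integral_const_mul]; congr 1; ext b; ring
    rw [e1, h, e2, ih (m+1)]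
    have e3 : j + 1 + m + 1 = j + (m + 1) + 1 := by ring
    have : (m + 1 : ℝ) ≠ 0 := by positivity
    simp only [KK, e3, Nat.factorial_succ j, Nat.factorial_succ m]
    push_cast
    simp
    field_simp

abbrev I5 : Set ℝ := Set.Icc 0 5
abbrev mu : Measure ℝ := volume.restrict I5
abbrev mu2 : Measure (ℝ × ℝ) := mu.prod mu

lemma int1 (c : ℝ) (hc : c ≤ 5) (m j : ℕ) :
    ∫ b, ph m (c - b) * b ^ j ∂mu = KK j m * ph (j + m + 1) c := by
  by_cases h : 0 < c
  · have e : ∀ b, Set.indicator I5 (fun b => ph m (c - b) * b ^ j) b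
        = Set.indicator (Set.Ico 0 c) (fun b => (c - b) ^ m * b ^ j) b := by
      intro b
      simp only [Set.indicator, Set.mem_Icc, Set.mem_Ico, ph, sub_pos]
      by_cases h0 : 0 ≤ b <;> by_cases h1 : b < c
      · have : b ≤ 5 := by linarith
        simp [h0, h1, this]
      · simp [h1]
      · simp [h0]
      · simp [h0]
    rw [← integral_indicator measurableSet_Icc]
    simp_rw [e]
    rw [integral_indicator measurableSet_Ico, integral_Ico_eq_integral_Ioo, ← integral_Ioc_eq_integral_Ioo, ← intervalIntegral.integral_of_le h.le, beta]
    simp [ph, h]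
  · rw [setIntegral_eq_zero_of_forall_eq_zero]
    · simp [ph, h]
    · intro x hx
      have : ¬ (0 < c - x) := by have := hx.1; linarith
      simp [ph, this]

lemma ae_mu : ∀ᵐ a ∂mu, 0 ≤ a ∧ a ≤ 5 := by
  simpa using ae_restrict_mem (μ := (volume : Measure ℝ)) (s := I5) measurableSet_Icc
lemma mu2_eq : mu2 = volume.restrict (I5 ×ˢ I5) := by
  rw [mu2, Measure.prod_restrict]; rfl
lemma ae_mu2 : ∀ᵐ z ∂mu2, (0 ≤ z.1 ∧ z.1 ≤ 5) ∧ (0 ≤ z.2 ∧ z.2 ≤ 5) := by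
  rw [mu2_eq]
  filter_upwards [ae_restrict_mem (μ := (volume : Measure (ℝ × ℝ))) (measurableSet_Icc.prod measurableSet_Icc)] with z hz
  exact hz

lemma integ2 (c : ℝ) (hc : c ≤ 5) (m i j : ℕ) :
    Integrable (fun z : ℝ × ℝ => ph m (c - z.1 - z.2) * (z.1 ^ i * z.2 ^ j)) mu2 := by
  apply Integrable.of_bound (C := 5 ^ m * (5 ^ i * 5 ^ j))
  · have := ph_meas m
    exact (Measurable.mul (this.comp (by fun_prop)) (by fun_prop)).aestronglyMeasurable
  · filter_upwards [ae_mu2] with z hz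
    obtain ⟨⟨h1, h2⟩, h3, h4⟩ := hz
    rw [norm_mul, Real.norm_eq_abs, Real.norm_eq_abs, abs_of_nonneg (a := z.1 ^ i * z.2 ^ j) (by positivity)]
    have := ph_bd m (c - z.1 - z.2) (by linarith)
    gcongr

lemma int2 (c : ℝ) (hc : c ≤ 5) (m i j : ℕ) :
    ∫ z, ph m (c - z.1 - z.2) * (z.1 ^ i * z.2 ^ j) ∂mu2
      = KK j m * KK i (j + m + 1) * ph (i + (j + m + 1) + 1) c := by
  rw [integral_prod _ (integ2 c hc m i j)]
  have : ∀ᵐ a ∂mu, ∫ b, ph m (c - a - b) * (a ^ i * b ^ j) ∂mu = KK j m * (ph (j+m+1) (c - a) * a ^ i) := by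
    filter_upwards [ae_mu] with a ha
    have h := int1 (c - a) (by linarith) m j
    have e : ∀ b, ph m (c - a - b) * (a ^ i * b ^ j) = a ^ i * (ph m (c - a - b) * b ^ j) := by intro b; ring
    simp_rw [e]
    rw [integral_const_mul, h]; ring
  rw [integral_congr_ae this, integral_const_mul, int1 c hc]; ring

lemma int_comb3 {X : Type*} [MeasurableSpace X] {μ : Measure X} {f g h : X → ℝ} (hf : Integrable f μ)
    (hg : Integrable g μ) (hh : Integrable h μ) :
    ∫ x, (f x - g x + h x) ∂μ = ∫ x, f x ∂μ - ∫ x, g x ∂μ + ∫ x, h x ∂μ := by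
  have hfg : Integrable (fun x => f x - g x) μ := hf.sub hg
  rw [integral_add hfg hh, integral_sub hf hg]

lemma int_comb4 {X : Type*} [MeasurableSpace X] {μ : Measure X} {f g h k : X → ℝ} (hf : Integrable f μ)
    (hg : Integrable g μ) (hh : Integrable h μ) (hk : Integrable k μ) :
    ∫ x, (4 * f x - 2 * g x - 2 * h x + k x) ∂μ
      = 4 * ∫ x, f x ∂μ - 2 * ∫ x, g x ∂μ - 2 * ∫ x, h x ∂μ + ∫ x, k x ∂μ := by
  have hfg : Integrable (fun x => 4 * f x - 2 * g x) μ := (hf.const_mul 4).sub (hg.const_mul 2)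
  rw [int_comb3 hfg (hh.const_mul 2) hk, integral_sub (hf.const_mul 4) (hg.const_mul 2),
    integral_const_mul, integral_const_mul, integral_const_mul]

/-- deficit weight -/
def gg (s : ℝ) : ℝ := ph 1 (2 - s) - ph 1 (1 - s) + ph 0 (1 - s)

lemma gg_meas : Measurable gg := by
  have h0 := ph_meas 0
  have h1 := ph_meas 1
  exact ((h1.comp (by fun_prop)).sub (h1.comp (by fun_prop))).add (h0.comp (by fun_prop))

lemma gg_zero (s : ℝ) (h : 2 ≤ s) : gg s = 0 := by
  have h1 : ¬ (0 < 2 - s) := by linarith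
  have h2 : ¬ (0 < 1 - s) := by linarith
  simp only [gg, ph, h1, h2, if_false]; norm_num

lemma gg_bd (s : ℝ) (h : 0 ≤ s) : |gg s| ≤ 2 := by
  rw [abs_le]
  simp only [gg, ph]
  split_ifs <;> constructor <;> norm_num <;> linarith

def MM (i j : ℕ) : ℝ := KK j 1 * KK i (j + 1 + 1) * (2 ^ (i + (j + 1 + 1) + 1) - 1)
  + KK j 0 * KK i (j + 0 + 1)

lemma gg_expand (i j : ℕ) : (fun z : ℝ × ℝ => gg (z.1 + z.2) * (z.1 ^ i * z.2 ^ j)) = 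
   fun z => ph 1 (2 - z.1 - z.2) * (z.1 ^ i * z.2 ^ j) - ph 1 (1 - z.1 - z.2) * (z.1 ^ i * z.2 ^ j)
     + ph 0 (1 - z.1 - z.2) * (z.1 ^ i * z.2 ^ j) := by
  ext z
  simp only [gg, ← sub_sub]; ring

lemma gg_integ (i j : ℕ) : Integrable (fun z : ℝ × ℝ => gg (z.1 + z.2) * (z.1 ^ i * z.2 ^ j)) mu2 := by
  rw [gg_expand]
  exact ((integ2 2 (by norm_num) 1 i j).sub (integ2 1 (by norm_num) 1 i j)).add (integ2 1 (by norm_num) 0 i j)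

lemma gg_int (i j : ℕ) : ∫ z, gg (z.1 + z.2) * (z.1 ^ i * z.2 ^ j) ∂mu2 = MM i j := by
  rw [gg_expand, int_comb3 (integ2 2 (by norm_num) 1 i j) (integ2 1 (by norm_num) 1 i j) (integ2 1 (by norm_num) 0 i j),
    int2 _ (by norm_num), int2 _ (by norm_num), int2 _ (by norm_num)]
  simp [ph, MM]; ring

/-- kernel -/
def TT (p : (ℝ × ℝ) × (ℝ × ℝ)) : ℝ :=
  (ph 2 (5 - p.1.1 - p.2.1) / 2) * (ph 2 (5 - p.1.2 - p.2.2) / 2)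

lemma TT_meas : Measurable TT := by
  have h := ph_meas 2
  exact ((h.comp (by fun_prop)).div_const 2).mul ((h.comp (by fun_prop)).div_const 2)

abbrev mu4 : Measure ((ℝ × ℝ) × (ℝ × ℝ)) := mu2.prod mu2

lemma ae_mu4 : ∀ᵐ p ∂mu4, ((0 ≤ p.1.1 ∧ p.1.1 ≤ 5) ∧ (0 ≤ p.1.2 ∧ p.1.2 ≤ 5)) ∧
    ((0 ≤ p.2.1 ∧ p.2.1 ≤ 5) ∧ (0 ≤ p.2.2 ∧ p.2.2 ≤ 5)) := by
  have h1 := Measure.quasiMeasurePreserving_fst (μ := mu2) (ν := mu2) |>.ae ae_mu2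
  have h2 := Measure.quasiMeasurePreserving_snd (μ := mu2) (ν := mu2) |>.ae ae_mu2
  filter_upwards [h1, h2] with p a b
  exact ⟨a, b⟩

lemma TT_bd (p : (ℝ × ℝ) × (ℝ × ℝ)) (h : ((0 ≤ p.1.1 ∧ p.1.1 ≤ 5) ∧ (0 ≤ p.1.2 ∧ p.1.2 ≤ 5)) ∧
    ((0 ≤ p.2.1 ∧ p.2.1 ≤ 5) ∧ (0 ≤ p.2.2 ∧ p.2.2 ≤ 5))) : |TT p| ≤ 625 := by
  obtain ⟨⟨⟨a, _⟩, b, _⟩, ⟨c, _⟩, d, _⟩ := h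
  have h1 := ph_bd 2 (5 - p.1.1 - p.2.1) (by linarith)
  have h2 := ph_bd 2 (5 - p.1.2 - p.2.2) (by linarith)
  rw [TT, abs_mul, abs_div, abs_div]
  calc _ ≤ (5 ^ 2 / |(2:ℝ)|) * (5 ^ 2 / |(2:ℝ)|) := by gcongr
    _ ≤ _ := by norm_num

lemma TT_integ (f : (ℝ × ℝ) × (ℝ × ℝ) → ℝ) (hf : Measurable f) (C : ℝ)
    (hC : ∀ p, 0 ≤ p.1.1 → 0 ≤ p.1.2 → 0 ≤ p.2.1 → 0 ≤ p.2.2 → |f p| ≤ C) :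
    Integrable (fun p => TT p * f p) mu4 := by
  apply Integrable.of_bound (C := 625 * C)
  · exact (TT_meas.mul hf).aestronglyMeasurable
  · filter_upwards [ae_mu4] with p hp
    have h1 := TT_bd p hp
    have h2 := hC p hp.1.1.1 hp.1.2.1 hp.2.1.1 hp.2.2.1
    rw [norm_mul, Real.norm_eq_abs, Real.norm_eq_abs]
    gcongr

lemma q_int (a : ℝ) (ha : 0 ≤ a) : ∫ b, ph 2 (5 - a - b) / 2 ∂mu = ph 3 (5 - a) / 6 := by
  have := int1 (5 - a) (by linarith) 2 0
  simp only [pow_zero, mul_one] at this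
  rw [integral_div, this]
  norm_num [KK, Nat.factorial]
  ring

lemma inner_int (z : ℝ × ℝ) (h1 : 0 ≤ z.1) (h2 : 0 ≤ z.2) :
    ∫ y, TT (z, y) ∂mu2 = (ph 3 (5 - z.1) / 6) * (ph 3 (5 - z.2) / 6) := by
  simp only [TT]
  rw [integral_prod_mul (fun x => ph 2 (5 - z.1 - x) / 2) (fun x => ph 2 (5 - z.2 - x) / 2), q_int _ h1, q_int _ h2]

lemma A0 : ∫ p, TT p ∂mu4 = (625 / 24) ^ 2 := by
  have hi := TT_integ (fun _ => 1) (by fun_prop) 1 (by simp)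
  simp only [mul_one] at hi
  rw [integral_prod _ hi]
  have : ∀ᵐ z ∂mu2, ∫ y, TT (z, y) ∂mu2 = (ph 3 (5 - z.1) / 6) * (ph 3 (5 - z.2) / 6) := by
    filter_upwards [ae_mu2] with z hz
    exact inner_int z hz.1.1 hz.2.1
  rw [integral_congr_ae this, integral_prod_mul (fun x => ph 3 (5 - x) / 6) (fun x => ph 3 (5 - x) / 6)]
  have := int1 5 le_rfl 3 0
  simp only [pow_zero, mul_one] at this
  rw [integral_div, this]
  norm_num [KK, Nat.factorial, ph]

def dd : Fin 4 → ℝ := ![125/6, -75/6, 15/6, -1/6]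

lemma A1 : ∫ p, TT p * gg (p.1.1 + p.1.2) ∂mu4 = ∑ i : Fin 4, ∑ j : Fin 4, dd i * dd j * MM i j := by
  have hi := TT_integ (fun p => gg (p.1.1 + p.1.2)) (gg_meas.comp (by fun_prop)) 2
    (fun p h1 h2 _ _ => gg_bd _ (by linarith))
  rw [integral_prod _ hi]
  have : ∀ᵐ z ∂mu2, ∫ y, TT (z, y) * gg (z.1 + z.2) ∂mu2 =
      ∑ i : Fin 4, ∑ j : Fin 4, dd i * dd j * (gg (z.1 + z.2) * (z.1 ^ (i:ℕ) * z.2 ^ (j:ℕ))) := by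
    filter_upwards [ae_mu2] with z hz
    rw [integral_mul_const, inner_int z hz.1.1 hz.2.1]
    by_cases h : 2 ≤ z.1 + z.2
    · simp [gg_zero _ h]
    · have a1 : 0 < 5 - z.1 := by linarith [hz.2.1]
      have a2 : 0 < 5 - z.2 := by linarith [hz.1.1]
      simp only [ph, a1, a2, if_true, Fin.sum_univ_four, dd]
      simp
      ring
  rw [integral_congr_ae this, integral_finsetSum]
  · refine Finset.sum_congr rfl fun i _ => ?_
    rw [integral_finsetSum]
    · refine Finset.sum_congr rfl fun j _ => ?_
      rw [integral_const_mul, gg_int]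
    · exact fun j _ => (gg_integ i j).const_mul _
  · exact fun i _ => integrable_finsetSum _ fun j _ => (gg_integ i j).const_mul _

lemma A2 : ∫ p, TT p * gg (p.2.1 + p.2.2) ∂mu4 = ∑ i : Fin 4, ∑ j : Fin 4, dd i * dd j * MM i j := by
  rw [← A1, ← integral_prod_swap]
  congr 1; ext p
  simp only [TT, Prod.fst_swap, Prod.snd_swap]
  rw [sub_right_comm 5 p.2.1, sub_right_comm 5 p.2.2]

def cc : Fin 3 × Fin 3 → ℝ := fun x => (!![25/2, -5, 1/2; -5, 1, 0; 1/2, 0, 0] : Matrix (Fin 3) (Fin 3) ℝ) x.1 x.2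

lemma A3 : ∫ p, TT p * (gg (p.1.1 + p.1.2) * gg (p.2.1 + p.2.2)) ∂mu4 =
    ∑ x : Fin 3 × Fin 3, ∑ y : Fin 3 × Fin 3, cc x * cc y * (MM x.1 y.1 * MM x.2 y.2) := by
  have : ∀ᵐ p ∂mu4, TT p * (gg (p.1.1 + p.1.2) * gg (p.2.1 + p.2.2)) =
      ∑ x : Fin 3 × Fin 3, ∑ y : Fin 3 × Fin 3, cc x * cc y *
        ((gg (p.1.1 + p.1.2) * (p.1.1 ^ (x.1:ℕ) * p.1.2 ^ (y.1:ℕ))) *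
         (gg (p.2.1 + p.2.2) * (p.2.1 ^ (x.2:ℕ) * p.2.2 ^ (y.2:ℕ)))) := by
    filter_upwards [ae_mu4] with p hp
    by_cases h : 2 ≤ p.1.1 + p.1.2
    · simp [gg_zero _ h]
    by_cases h' : 2 ≤ p.2.1 + p.2.2
    · simp [gg_zero _ h']
    obtain ⟨⟨⟨a, _⟩, b, _⟩, ⟨c, _⟩, d, _⟩ := hp
    have a1 : 0 < 5 - p.1.1 - p.2.1 := by linarith
    have a2 : 0 < 5 - p.1.2 - p.2.2 := by linarith
    have e : ∀ s t : ℝ, (5 - s - t) ^ 2 / 2 = ∑ x : Fin 3 × Fin 3, cc x * (s ^ (x.1:ℕ) * t ^ (x.2:ℕ)) := by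
      intro s t
      simp [Fintype.sum_prod_type, Fin.sum_univ_three, cc]
      ring
    simp only [TT, ph, a1, a2, if_true, e]
    rw [Finset.sum_mul_sum, Finset.sum_mul]
    refine Finset.sum_congr rfl fun x _ => ?_
    rw [Finset.sum_mul]
    refine Finset.sum_congr rfl fun y _ => ?_
    ring
  have hI : ∀ x y : Fin 3 × Fin 3, Integrable (fun p : (ℝ × ℝ) × (ℝ × ℝ) => cc x * cc y *
        ((gg (p.1.1 + p.1.2) * (p.1.1 ^ (x.1:ℕ) * p.1.2 ^ (y.1:ℕ))) *
         (gg (p.2.1 + p.2.2) * (p.2.1 ^ (x.2:ℕ) * p.2.2 ^ (y.2:ℕ))))) mu4 :=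
    fun x y => ((gg_integ x.1 y.1).mul_prod (gg_integ x.2 y.2)).const_mul _
  rw [integral_congr_ae this, integral_finsetSum]
  · refine Finset.sum_congr rfl fun x _ => ?_
    rw [integral_finsetSum]
    · refine Finset.sum_congr rfl fun y _ => ?_
      rw [integral_const_mul, integral_prod_mul (fun z : ℝ × ℝ => gg (z.1 + z.2) * (z.1 ^ (x.1:ℕ) * z.2 ^ (y.1:ℕ)))
        (fun z : ℝ × ℝ => gg (z.1 + z.2) * (z.1 ^ (x.2:ℕ) * z.2 ^ (y.2:ℕ))), gg_int, gg_int]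
    · exact fun y _ => hI x y
  · exact fun x _ => integrable_finsetSum _ fun y _ => hI x y

def FF (p : (ℝ × ℝ) × (ℝ × ℝ)) : ℝ := TT p * ((2 - gg (p.1.1 + p.1.2)) * (2 - gg (p.2.1 + p.2.2)))

lemma gm1 : Measurable (fun p : (ℝ × ℝ) × (ℝ × ℝ) => gg (p.1.1 + p.1.2)) := gg_meas.comp (by fun_prop)
lemma gm2 : Measurable (fun p : (ℝ × ℝ) × (ℝ × ℝ) => gg (p.2.1 + p.2.2)) := gg_meas.comp (by fun_prop)

lemma FF_integ : Integrable FF mu4 := by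
  apply TT_integ _ ((gm1.const_sub 2).mul (gm2.const_sub 2)) 16
  intro p h1 h2 h3 h4
  have := gg_bd (p.1.1 + p.1.2) (by linarith)
  have := gg_bd (p.2.1 + p.2.2) (by linarith)
  simp only [Pi.mul_apply]
  rw [abs_mul]
  have h5 : |2 - gg (p.1.1 + p.1.2)| ≤ 4 := by rw [abs_le] at *; constructor <;> linarith
  have h6 : |2 - gg (p.2.1 + p.2.2)| ≤ 4 := by rw [abs_le] at *; constructor <;> linarith
  calc _ ≤ (4:ℝ) * 4 := by gcongr
    _ = 16 := by norm_num

lemma FF_int : ∫ p, FF p ∂mu4 = 1160242379 / 907200 := by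
  have i0 := TT_integ (fun _ => 1) (by fun_prop) 1 (by simp)
  simp only [mul_one] at i0
  have i1 := TT_integ _ gm1 2 (fun p h1 h2 _ _ => gg_bd _ (by linarith))
  have i2 := TT_integ _ gm2 2 (fun p _ _ h1 h2 => gg_bd _ (by linarith))
  have i3 := TT_integ _ (gm1.mul gm2) 4 (fun p h1 h2 h3 h4 => by
    simp only [Pi.mul_apply]
    rw [abs_mul]
    have := gg_bd (p.1.1 + p.1.2) (by linarith)
    have := gg_bd (p.2.1 + p.2.2) (by linarith)
    calc _ ≤ (2:ℝ) * 2 := by gcongr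
      _ = 4 := by norm_num)
  have e : FF = fun p => (4 * TT p - 2 * (TT p * gg (p.1.1 + p.1.2))) - 2 * (TT p * gg (p.2.1 + p.2.2))
      + TT p * (gg (p.1.1 + p.1.2) * gg (p.2.1 + p.2.2)) := by
    ext p; simp only [FF]; ring
  simp only [Pi.mul_apply] at i3
  rw [e, int_comb4 i0 i1 i2 i3,
    A0, A1, A2, A3]
  simp [Fintype.sum_prod_type, Fin.sum_univ_three, Fin.sum_univ_four, dd, cc, MM, KK, Nat.factorial]
  norm_num

def Tri (s : ℝ) : Set (ℝ × ℝ) := {q | 0 ≤ q.1 ∧ 0 ≤ q.2 ∧ q.1 + q.2 ≤ s}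
def UU (s : ℝ) : Set ℝ := {u | -1 ≤ u ∧ u ≤ 1 ∧ 1 ≤ s ∧ 1 ≤ s + u}

lemma Tri_meas (s : ℝ) : MeasurableSet (Tri s) := by
  simp only [Tri]
  refine IsClosed.measurableSet ?_
  simp only [Set.ofPred_and]
  repeat' apply IsClosed.inter
  all_goals exact isClosed_le (by fun_prop) (by fun_prop)

lemma Tri_vol (s : ℝ) (hs : s ≤ 5) : volume (Tri s) = ENNReal.ofReal (ph 2 s / 2) := by
  rw [Measure.volume_eq_prod, Measure.prod_apply (Tri_meas s)]
  have : ∀ x : ℝ, volume (Prod.mk x ⁻¹' Tri s) = I5.indicator (fun x => ENNReal.ofReal (ph 1 (s - x))) x := by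
    intro x
    by_cases hx : x ∈ I5
    · have e : Prod.mk x ⁻¹' Tri s = Set.Icc 0 (s - x) := by
        ext y
        have := hx.1
        simp only [Tri, Set.mem_preimage, Set.mem_ofPred_eq, Set.mem_Icc]
        constructor
        · rintro ⟨_, h2, h3⟩; exact ⟨h2, by linarith⟩
        · rintro ⟨h2, h3⟩; exact ⟨this, h2, by linarith⟩
      rw [e, Real.volume_Icc, Set.indicator_of_mem hx, sub_zero]
      by_cases h : 0 < s - x
      · simp [ph, h]
      · rw [ENNReal.ofReal_of_nonpos (by linarith)]; simp only [ph, h, if_false, ENNReal.ofReal_zero]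
    · have e : Prod.mk x ⁻¹' Tri s = ∅ := by
        ext y
        simp only [Tri, Set.mem_preimage, Set.mem_ofPred_eq, Set.mem_empty_iff_false, iff_false]
        rintro ⟨h1, h2, h3⟩
        exact hx ⟨h1, by linarith⟩
      rw [e, Set.indicator_of_notMem hx, measure_empty]
  simp_rw [this]
  rw [lintegral_indicator measurableSet_Icc, ← ofReal_integral_eq_lintegral_ofReal]
  · have := int1 s hs 1 0
    simp only [pow_zero, mul_one] at this
    rw [this]
    congr 1
    norm_num [KK, Nat.factorial]
    ring
  · have hm : Measurable (fun x : ℝ => ph 1 (s - x)) := (ph_meas 1).comp (measurable_const.sub measurable_id)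
    refine Integrable.of_bound hm.aestronglyMeasurable (5 ^ 1) ?_
    filter_upwards [ae_mu] with a ha
    exact ph_bd 1 _ (by linarith)
  · exact Filter.Eventually.of_forall fun x => ph_nonneg 1 _

lemma UU_vol (s : ℝ) (hs : 0 ≤ s) : volume (UU s) = ENNReal.ofReal (2 - gg s) := by
  rcases lt_or_ge s 1 with h1 | h1
  · have e : UU s = ∅ := by
      ext u
      simp only [UU, Set.mem_ofPred_eq, Set.mem_empty_iff_false, iff_false]
      rintro ⟨_, _, h, _⟩; linarith
    have a1 : 0 < 2 - s := by linarith
    have a2 : 0 < 1 - s := by linarith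
    rw [e, measure_empty, eq_comm, ENNReal.ofReal_eq_zero]
    simp only [gg, ph, a1, a2, if_true]; norm_num
  · have a2 : ¬ 0 < 1 - s := by linarith
    rcases lt_or_ge s 2 with h2 | h2
    · have e : UU s = Set.Icc (1 - s) 1 := by
        ext u
        simp only [UU, Set.mem_ofPred_eq, Set.mem_Icc]
        constructor
        · rintro ⟨_, h, _, h'⟩; constructor <;> linarith
        · rintro ⟨h, h'⟩; refine ⟨?_, ?_, ?_, ?_⟩ <;> linarith
      have a1 : 0 < 2 - s := by linarith
      rw [e, Real.volume_Icc]
      congr 1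
      simp only [gg, ph, a1, a2, if_true, if_false]; ring
    · have e : UU s = Set.Icc (-1) 1 := by
        ext u
        simp only [UU, Set.mem_ofPred_eq, Set.mem_Icc]
        constructor
        · rintro ⟨h, h', _⟩; exact ⟨h, h'⟩
        · rintro ⟨h, h'⟩; refine ⟨?_, ?_, ?_, ?_⟩ <;> linarith
      rw [e, Real.volume_Icc, gg_zero s h2]
      norm_num

abbrev EE := ((ℝ × ℝ) × (ℝ × ℝ)) × ((ℝ × ℝ) × ((ℝ × ℝ) × (ℝ × ℝ)))

/-- Coordinates `((a₁,b₁),(a₂,b₂)),((a₃,a₄),((b₃,b₄),(u,v)))`. -/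
def coord (p : EE) : Fin 10 → ℝ :=
  ![p.1.1.1 - 1, p.1.2.1 - 1, p.2.1.1 - 1, p.2.1.2 - 1,
    p.1.1.2 - 1, p.1.2.2 - 1, p.2.2.1.1 - 1, p.2.2.1.2 - 1, p.2.2.2.1, p.2.2.2.2]

lemma coord_mp : MeasurePreserving coord volume volume := by
  have hm : Measurable coord := by
    rw [measurable_pi_iff]
    intro i
    fin_cases i <;> simp [coord] <;> fun_prop
  refine ⟨hm, ?_⟩
  rw [volume_pi]
  symm
  apply Measure.pi_eq
  intro s hs
  rw [Measure.map_apply hm (MeasurableSet.univ_pi hs)]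
  have e : coord ⁻¹' (Set.univ.pi s) =
      ((((fun x => x - 1) ⁻¹' s 0) ×ˢ ((fun x => x - 1) ⁻¹' s 4)) ×ˢ
       (((fun x => x - 1) ⁻¹' s 1) ×ˢ ((fun x => x - 1) ⁻¹' s 5))) ×ˢ
      ((((fun x => x - 1) ⁻¹' s 2) ×ˢ ((fun x => x - 1) ⁻¹' s 3)) ×ˢ
       ((((fun x => x - 1) ⁻¹' s 6) ×ˢ ((fun x => x - 1) ⁻¹' s 7)) ×ˢ (s 8 ×ˢ s 9))) := by
    ext p
    simp [coord, Set.mem_pi, Fin.forall_fin_succ]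
    tauto
  rw [e]
  simp only [Measure.volume_eq_prod, Measure.prod_prod, sub_eq_add_neg, measure_preimage_add_right]
  simp only [Fin.prod_univ_succ]
  simp
  ring

def SS : Set EE := {p | (0 ≤ p.1.1.1 ∧ 0 ≤ p.1.1.2 ∧ 0 ≤ p.1.2.1 ∧ 0 ≤ p.1.2.2) ∧
  p.2.1 ∈ Tri (5 - p.1.1.1 - p.1.2.1) ∧ p.2.2.1 ∈ Tri (5 - p.1.1.2 - p.1.2.2) ∧
  p.2.2.2.1 ∈ UU (p.1.1.1 + p.1.1.2) ∧ p.2.2.2.2 ∈ UU (p.1.2.1 + p.1.2.2)}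

lemma SS_meas : MeasurableSet SS := by
  simp only [SS, Tri, UU, Set.mem_ofPred_eq]
  refine IsClosed.measurableSet ?_
  simp only [Set.ofPred_and]
  repeat' apply IsClosed.inter
  all_goals exact isClosed_le (by fun_prop) (by fun_prop)

lemma fiber (p : (ℝ × ℝ) × (ℝ × ℝ)) : volume (Prod.mk p ⁻¹' SS) =
    ((I5 ×ˢ I5) ×ˢ (I5 ×ˢ I5)).indicator (fun p => ENNReal.ofReal (FF p)) p := by
  by_cases hp : p ∈ (I5 ×ˢ I5) ×ˢ (I5 ×ˢ I5)
  · rw [Set.indicator_of_mem hp]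
    obtain ⟨⟨⟨a, _⟩, b, _⟩, ⟨c, _⟩, d, _⟩ := hp
    have e : Prod.mk p ⁻¹' SS = Tri (5 - p.1.1 - p.2.1) ×ˢ (Tri (5 - p.1.2 - p.2.2) ×ˢ
        (UU (p.1.1 + p.1.2) ×ˢ UU (p.2.1 + p.2.2))) := by
      ext q
      simp only [SS, Set.mem_preimage, Set.mem_ofPred_eq, Set.mem_prod]
      tauto
    rw [e]
    simp only [Measure.volume_eq_prod, Measure.prod_prod]
    simp only [← Measure.volume_eq_prod]
    have g1 := abs_le.1 (gg_bd (p.1.1 + p.1.2) (by linarith))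
    rw [Tri_vol _ (by linarith), Tri_vol _ (by linarith), UU_vol _ (by linarith), UU_vol _ (by linarith)]
    have n1 := ph_nonneg 2 (5 - p.1.1 - p.2.1)
    have n2 := ph_nonneg 2 (5 - p.1.2 - p.2.2)
    rw [← ENNReal.ofReal_mul (by linarith), ← ENNReal.ofReal_mul (by positivity), ← ENNReal.ofReal_mul (by positivity)]
    congr 1
    simp only [FF, TT]; ring
  · rw [Set.indicator_of_notMem hp]
    have e : Prod.mk p ⁻¹' SS = ∅ := by
      ext q
      simp only [SS, Tri, Set.mem_preimage, Set.mem_ofPred_eq, Set.mem_empty_iff_false, iff_false]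
      rintro ⟨⟨a, b, c, d⟩, ⟨h1, h2, h3⟩, ⟨h4, h5, h6⟩, _⟩
      apply hp
      refine ⟨⟨⟨a, ?_⟩, b, ?_⟩, ⟨c, ?_⟩, d, ?_⟩ <;> linarith
    rw [e, measure_empty]

lemma mu4_eq : mu4 = volume.restrict ((I5 ×ˢ I5) ×ˢ (I5 ×ˢ I5)) := by
  rw [mu4, mu2_eq, Measure.prod_restrict]; rfl

lemma SS_vol : volume SS = ENNReal.ofReal (1160242379 / 907200) := by
  rw [Measure.volume_eq_prod, Measure.prod_apply SS_meas]
  simp_rw [fiber]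
  rw [lintegral_indicator ((measurableSet_Icc.prod measurableSet_Icc).prod (measurableSet_Icc.prod measurableSet_Icc)),
    ← mu4_eq, ← ofReal_integral_eq_lintegral_ofReal FF_integ, FF_int]
  filter_upwards [ae_mu4] with p hp
  have g1 := abs_le.1 (gg_bd (p.1.1 + p.1.2) (by linarith [hp.1.1.1, hp.1.2.1]))
  have g2 := abs_le.1 (gg_bd (p.2.1 + p.2.2) (by linarith [hp.2.1.1, hp.2.2.1]))
  have n1 := ph_nonneg 2 (5 - p.1.1 - p.2.1)
  have n2 := ph_nonneg 2 (5 - p.1.2 - p.2.2)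
  simp only [FF, TT, Pi.zero_apply]
  have m1 : 0 ≤ 2 - gg (p.1.1 + p.1.2) := by linarith
  have m2 : 0 ≤ 2 - gg (p.2.1 + p.2.2) := by linarith
  positivity


/-- The 10-dimensional Lebesgue measure of `P` equals
`1160242379 / 907200`. -/
theorem stmt9 : volume P = ENNReal.ofReal (1160242379 / 907200) := by
  have hmp := (EuclideanSpace.volume_preserving_symm_measurableEquiv_toLp (Fin 10)).symm
  have h1 : volume P = volume ((MeasurableEquiv.toLp 2 (Fin 10 → ℝ)) ⁻¹' P) :=
    (hmp.measure_preimage_equiv _).symm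
  have hc : coord ⁻¹' ((MeasurableEquiv.toLp 2 (Fin 10 → ℝ)) ⁻¹' P) = SS := by
    ext p
    simp only [Set.mem_preimage, P, V18, Set.mem_ofPred_eq, Set.mem_insert_iff, Set.mem_singleton_iff,
      forall_eq_or_imp, forall_eq, ee, inner_neg_right, inner_add_right, EuclideanSpace.inner_single_right]
    simp [coord, SS, Tri, UU]
    constructor
    · intro h
      refine ⟨⟨?_, ?_, ?_, ?_⟩, ⟨?_, ?_, ?_⟩, ⟨?_, ?_, ?_⟩, ⟨?_, ?_, ?_, ?_⟩, ?_, ?_, ?_, ?_⟩ <;> linarith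
    · intro h
      refine ⟨?_, ?_, ?_, ?_, ?_, ?_, ?_, ?_, ?_, ?_, ?_, ?_, ?_, ?_, ?_, ?_, ?_, ?_⟩ <;> linarith
  have hP : MeasurableSet P := by
    refine IsClosed.measurableSet ?_
    have e : P = ⋂ v ∈ V18, {x : EuclideanSpace ℝ (Fin 10) | -1 ≤ ⟪x, v⟫} := by
      ext x; simp [P]
    rw [e]
    exact isClosed_biInter fun v _ => isClosed_le (by fun_prop) (by fun_prop)
  rw [h1, ← coord_mp.measure_preimage ((MeasurableEquiv.measurable _) hP).nullMeasurableSet, hc, SS_vol]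
end
end
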